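/- arXiv:1502.07809 — 2 statements merged into one kernel-verified Lean document; each statement's English description precedes it below -/
import Mathlib

section
/- For every state x ∈ ℕ^N, every action u ∈ {0,1}^N, and every z ∈ ℕ^N with z_n ≤ τ_n for all n, the probability that the random next state Y from (x, u) satisfies Y ∧ τ = z equals the probability that the random next state Y′ from (x ∧ τ, u) satisfies Y′ ∧ τ = z; in other words, the distribution of Y ∧ τ depends on x only through x ∧ τ (so that the truncated process X(t) ∧ τ is itself a Markov decision process). -/
open Finset

/-- Probability weight of the delivery-outcome vector `d` (coordinate `n` delivers iff
`d n = true`) when action `u` is taken: coordinates are independent; if `u n = true` the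
packet of client `n` is delivered with probability `p n`, otherwise it is never delivered. -/
noncomputable def deliveryWeight {N : ℕ} (p : Fin N → ℝ) (u d : Fin N → Bool) : ℝ :=
  ∏ n, (if u n then (if d n then p n else 1 - p n) else (if d n then 0 else 1))

/-- The next state: `0` for a client whose packet was delivered, `x n + 1` otherwise. -/
def nextState {N : ℕ} (x : Fin N → ℕ) (d : Fin N → Bool) : Fin N → ℕ :=
  fun n => if d n then 0 else x n + 1

/-- Admissible actions: subsets of at most `L` clients allowed to transmit. -/
def admissible (N L : ℕ) : Finset (Fin N → Bool) :=
  Finset.univ.filter (fun u => (Finset.univ.filter (fun n => u n = true)).card ≤ L)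

lemma admissible_nonempty (N L : ℕ) : (admissible N L).Nonempty :=
  ⟨fun _ => false, by simp [admissible]⟩

/-- The finite-horizon optimal cost `V T x` of MDP-1, defined by the dynamic-programming
recursion: `V 0 x = ∑ n max(x n − τ n, 0)` and
`V (T+1) x = min over admissible u of [η ∑ E n u n + E(∑ max(x n + 1 − τ n,0) 1{Y n = 0} + V T Y)]`. -/
noncomputable def V {N : ℕ} (p : Fin N → ℝ) (τ : Fin N → ℕ) (E : Fin N → ℝ) (η : ℝ)
    (L : ℕ) : ℕ → (Fin N → ℕ) → ℝ
  | 0, x => ∑ n, ((x n - τ n : ℕ) : ℝ)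
  | T + 1, x =>
      (admissible N L).inf' (admissible_nonempty N L) (fun u =>
        η * ∑ n, E n * (if u n then 1 else 0) +
        ∑ d : Fin N → Bool, deliveryWeight p u d *
          ((∑ n, ((x n + 1 - τ n : ℕ) : ℝ) * (if nextState x d n = 0 then 1 else 0)) +
            V p τ E η L T (nextState x d)))

/-- Truncating the current state at `τ` does not change the truncated next state. -/
lemma min_nextState_min {N : ℕ} (x τ : Fin N → ℕ) (d : Fin N → Bool) (n : Fin N) :
    min (nextState (fun m => min (x m) (τ m)) d n) (τ n) = min (nextState x d n) (τ n) := by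
  simp only [nextState]
  split_ifs <;> omega

/-- for every state `x`, action `u`, and `z` with `zₙ ≤ τₙ` for all `n`, the
probability that the random next state `Y` from `(x, u)` satisfies `Y ∧ τ = z` equals the
probability that the random next state `Y′` from `(x ∧ τ, u)` satisfies `Y′ ∧ τ = z`:
the distribution of `Y ∧ τ` depends on `x` only through `x ∧ τ`, so the truncated process
`X(t) ∧ τ` is itself a Markov decision process. -/
theorem statement4 (N : ℕ) (hN : 1 ≤ N)
    (p : Fin N → ℝ) (hp : ∀ n, 0 < p n ∧ p n < 1)
    (τ : Fin N → ℕ) (hτ : ∀ n, 1 ≤ τ n)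
    (x : Fin N → ℕ) (u : Fin N → Bool) (z : Fin N → ℕ) (hz : ∀ n, z n ≤ τ n) :
    (∑ d : Fin N → Bool, deliveryWeight p u d *
        (if (fun n => min (nextState x d n) (τ n)) = z then (1 : ℝ) else 0)) =
      ∑ d : Fin N → Bool, deliveryWeight p u d *
        (if (fun n => min (nextState (fun m => min (x m) (τ m)) d n) (τ n)) = z
          then (1 : ℝ) else 0) := by
  simp only [min_nextState_min]
end

section
/- For every horizon T ≥ 0 and every state x in the finite state space S = ∏_n {0,1,…,τ_n}, the truncated value function satisfies W_T(x) = V_T(x); that is, the finite-state MDP with truncated dynamics and one-step cost Σ_n ( η E_n u_n + 1{x_n = τ_n} ) is equivalent to the original infinite-state problem on S. -/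
open Finset

/-- The value function `W` of the truncated finite-state model MDP-2 on
`S = ∏ₙ {0,…,τₙ}`: `W 0 ≡ 0` and
`W (T+1) x = min over admissible u of [∑ₙ (η Eₙ uₙ + 1{xₙ = τₙ}) + E(W T Z)]`,
where `Zₙ = 0` on delivery and `Zₙ = min(xₙ + 1, τₙ)` otherwise. -/
noncomputable def Wtrunc {N : ℕ} (p : Fin N → ℝ) (τ : Fin N → ℕ) (E : Fin N → ℝ) (η : ℝ)
    (L : ℕ) : ℕ → (Fin N → ℕ) → ℝ
  | 0, _ => 0
  | T + 1, x =>
      (admissible N L).inf' (admissible_nonempty N L) (fun u =>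
        (∑ n, (η * E n * (if u n then 1 else 0) + (if x n = τ n then (1 : ℝ) else 0))) +
          ∑ d : Fin N → Bool, deliveryWeight p u d *
            Wtrunc p τ E η L T (fun n => if d n then 0 else min (x n + 1) (τ n)))

lemma sum_deliveryWeight {N : ℕ} (p : Fin N → ℝ) (u : Fin N → Bool) :
    ∑ d : Fin N → Bool, deliveryWeight p u d = 1 := by
  have h := Fintype.prod_sum (fun (n : Fin N) (b : Bool) =>
    (if u n then (if b then p n else 1 - p n) else (if b then 0 else 1) : ℝ))
  unfold deliveryWeight
  rw [← h]
  refine Finset.prod_eq_one fun n _ => ?_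
  cases u n <;> simp

/-- The excess incurred at a transition, counted at delivery or carried over in the next state,
does not depend on the delivery outcome. -/
lemma excess_nextState {N : ℕ} (τ x : Fin N → ℕ) (d : Fin N → Bool) :
    (∑ n, ((x n + 1 - τ n : ℕ) : ℝ) * (if nextState x d n = 0 then 1 else 0)) +
      ∑ n, ((nextState x d n - τ n : ℕ) : ℝ) = ∑ n, ((x n + 1 - τ n : ℕ) : ℝ) := by
  rw [← Finset.sum_add_distrib]
  refine Finset.sum_congr rfl fun n _ => ?_
  unfold nextState
  cases d n <;> simp

lemma excess_succ (x τ : ℕ) :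
    ((x + 1 - τ : ℕ) : ℝ) = (if min x τ = τ then 1 else 0) + ((x - τ : ℕ) : ℝ) := by
  split_ifs with h
  · rw [show x + 1 - τ = 1 + (x - τ) by omega]
    push_cast
    rfl
  · rw [show x + 1 - τ = 0 by omega, show x - τ = 0 by omega]
    simp

lemma min_nextState {N : ℕ} (τ x : Fin N → ℕ) (d : Fin N → Bool) :
    (fun n => min (nextState x d n) (τ n)) =
      fun n => if d n then 0 else min (min (x n) (τ n) + 1) (τ n) := by
  funext n
  unfold nextState
  split_ifs <;> omega

/-- On the whole of `ℕ^N`, the original value function is the truncated one at the truncated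
state plus the excess over the thresholds. -/
lemma V_eq_Wtrunc_add_excess {N : ℕ} (p : Fin N → ℝ) (τ : Fin N → ℕ) (E : Fin N → ℝ) (η : ℝ)
    (L T : ℕ) (x : Fin N → ℕ) :
    V p τ E η L T x =
      Wtrunc p τ E η L T (fun n => min (x n) (τ n)) + ∑ n, ((x n - τ n : ℕ) : ℝ) := by
  induction T generalizing x with
  | zero => simp [V, Wtrunc]
  | succ T ih =>
    rw [V, Wtrunc, Finset.apply_inf'_eq_inf'_comp (admissible_nonempty N L)
      (fun r : ℝ => r + ∑ n, ((x n - τ n : ℕ) : ℝ)) fun a b => (min_add_add_right a b _).symm]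
    refine Finset.inf'_congr _ rfl fun u _ => ?_
    have hstep (d : Fin N → Bool) : deliveryWeight p u d *
        ((∑ n, ((x n + 1 - τ n : ℕ) : ℝ) * (if nextState x d n = 0 then 1 else 0)) +
          V p τ E η L T (nextState x d)) =
        deliveryWeight p u d * ∑ n, ((x n + 1 - τ n : ℕ) : ℝ) + deliveryWeight p u d *
          Wtrunc p τ E η L T
            (fun n => if d n then 0 else min (min (x n) (τ n) + 1) (τ n)) := by
      rw [ih, min_nextState, ← excess_nextState τ x d]
      ring
    have hexcess : ∑ n, ((x n + 1 - τ n : ℕ) : ℝ) =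
        ∑ n, (if min (x n) (τ n) = τ n then (1 : ℝ) else 0) + ∑ n, ((x n - τ n : ℕ) : ℝ) := by
      rw [← Finset.sum_add_distrib]
      exact Finset.sum_congr rfl fun n _ => excess_succ _ _
    simp only [Function.comp_apply, hstep]
    rw [Finset.sum_add_distrib, ← Finset.sum_mul, sum_deliveryWeight, hexcess,
      Finset.sum_add_distrib, Finset.mul_sum]
    simp only [mul_assoc]
    ring

/-- for every horizon `T` and state `x` in the finite state space
`S = ∏ₙ {0,…,τₙ}`, the truncated value function satisfies `W_T(x) = V_T(x)`: the
finite-state MDP-2 is equivalent to the original infinite-state problem on `S`. -/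
theorem statement5 (N : ℕ) (hN : 1 ≤ N) (L : ℕ) (hL1 : 1 ≤ L) (hLN : L ≤ N)
    (p : Fin N → ℝ) (hp : ∀ n, 0 < p n ∧ p n < 1)
    (τ : Fin N → ℕ) (hτ : ∀ n, 1 ≤ τ n)
    (E : Fin N → ℝ) (hE : ∀ n, 0 ≤ E n)
    (η : ℝ) (hη : 0 ≤ η)
    (T : ℕ) (x : Fin N → ℕ) (hx : ∀ n, x n ≤ τ n) :
    Wtrunc p τ E η L T x = V p τ E η L T x := by
  have hmin : (fun n => min (x n) (τ n)) = x := funext fun n => min_eq_left (hx n)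
  have hexcess : ∑ n, ((x n - τ n : ℕ) : ℝ) = 0 :=
    Finset.sum_eq_zero fun n _ => by rw [Nat.sub_eq_zero_of_le (hx n), Nat.cast_zero]
  rw [V_eq_Wtrunc_add_excess, hmin, hexcess, add_zero]
end
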